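/- Let k be a finite field of characteristic p ≠ 2 and suppose n = 2r for some r ≥ 1. Let R be an algebraically closed field of characteristic different from p and let ρ be a cuspidal irreducible R-representation of GL_n(k). Then the R-vector space Hom_{(GL_r × GL_r)(k)}(ρ, 1) of (GL_r × GL_r)(k)-invariant linear forms on ρ has dimension at most 1. -/

import Mathlib

open Matrix

section InvariantForms

variable {R : Type} [CommRing R] {G : Type} [Monoid G] {V : Type} [AddCommGroup V] [Module R V]

/-- The space of `H`-invariant `R`-linear forms on a representation `ρ`. -/
def invariantForms (ρ : Representation R G V) (H : Set G) : Submodule R (V →ₗ[R] R) where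
  carrier := {φ | ∀ g ∈ H, ∀ v : V, φ (ρ g v) = φ v}
  add_mem' := by
    intro φ ψ hφ hψ g hg v
    simp only [LinearMap.add_apply, hφ g hg v, hψ g hg v]
  zero_mem' := by intro g hg v; simp
  smul_mem' := by
    intro c φ hφ g hg v
    simp only [LinearMap.smul_apply, hφ g hg v]

/-- A representation is irreducible if it is nonzero and its only invariant submodules
are `⊥` and `⊤`. -/
def IsIrreducibleRep (ρ : Representation R G V) : Prop :=
  (⊥ : Submodule R V) ≠ ⊤ ∧
    ∀ W : Submodule R V, (∀ g : G, ∀ v ∈ W, ρ g v ∈ W) → W = ⊥ ∨ W = ⊤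

/-- Two representations are isomorphic if there is an equivariant linear equivalence. -/
def RepIso {W : Type} [AddCommGroup W] [Module R W]
    (ρ : Representation R G V) (τ : Representation R G W) : Prop :=
  ∃ e : V ≃ₗ[R] W, ∀ (g : G) (v : V), e (ρ g v) = τ g (e v)

/-- `ρ` is (isomorphic to) a subquotient of `τ`:  there is a `τ`-invariant submodule `q`
together with an equivariant surjection from `q` onto the space of `ρ`. -/
def IsSubquotientOf {W : Type} [AddCommGroup W] [Module R W]
    (ρ : Representation R G V) (τ : Representation R G W) : Prop :=
  ∃ (q : Submodule R W) (hq : ∀ g : G, ∀ w ∈ q, τ g w ∈ q) (f : ↥q →ₗ[R] V),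
    Function.Surjective f ∧
      ∀ (g : G) (w : ↥q), f ⟨τ g w.1, hq g w.1 w.2⟩ = ρ g (f w)

end InvariantForms
section Cuspidal

variable (k : Type) [Field k]

/-- A representation of `GL n k` is cuspidal if it has no nonzero vector invariant under the
unipotent radical of a proper (maximal) parabolic subgroup. -/
def IsCuspidal {R : Type} [CommRing R] {n : ℕ} {V : Type} [AddCommGroup V] [Module R V]
    (ρ : Representation R (GL (Fin n) k) V) : Prop :=
  ∀ a b : ℕ, 0 < a → 0 < b → a + b = n →
    ∀ v : V,
      (∀ g : GL (Fin n) k,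
        (∀ i j : Fin n, ¬((i : ℕ) < a ∧ a ≤ (j : ℕ)) →
          (g : Matrix (Fin n) (Fin n) k) i j = (1 : Matrix (Fin n) (Fin n) k) i j) →
        ρ g v = v) → v = 0

end Cuspidal
section Levi

variable (k : Type) [Field k]

lemma levi_mem_iff {n r : ℕ} (B : Fin n → Fin r) (M : Matrix (Fin n) (Fin n) k) :
    (∀ i j, B i ≠ B j → M i j = 0) ↔
      (Matrix.BlockTriangular M B ∧ Matrix.BlockTriangular M (OrderDual.toDual ∘ B)) := by
  constructor
  · intro h
    refine ⟨fun i j hij => h i j (ne_of_gt hij), fun i j hij => h i j (ne_of_lt ?_)⟩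
    exact OrderDual.toDual_lt_toDual.mp hij
  · rintro ⟨h₁, h₂⟩ i j hij
    rcases lt_or_gt_of_ne hij with hlt | hgt
    · exact h₂ (by simpa using hlt)
    · exact h₁ hgt

/-- The block-diagonal Levi subgroup of `GL n k` attached to a block function `B`. -/
def levi (n r : ℕ) (B : Fin n → Fin r) : Subgroup (GL (Fin n) k) where
  carrier := {g | ∀ i j, B i ≠ B j → (g : Matrix (Fin n) (Fin n) k) i j = 0}
  one_mem' := by
    intro i j hij
    have hne : i ≠ j := fun h => hij (by rw [h])
    simp [Matrix.one_apply, hne]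
  mul_mem' := by
    intro a b ha hb
    have h : ((a * b : GL (Fin n) k) : Matrix (Fin n) (Fin n) k)
        = (a : Matrix (Fin n) (Fin n) k) * (b : Matrix (Fin n) (Fin n) k) := rfl
    rw [Set.mem_setOf_eq] at ha hb ⊢
    rw [levi_mem_iff] at ha hb ⊢
    rw [h]
    exact ⟨ha.1.mul hb.1, ha.2.mul hb.2⟩
  inv_mem' := by
    intro a ha
    have h : ((a⁻¹ : GL (Fin n) k) : Matrix (Fin n) (Fin n) k)
        = (a : Matrix (Fin n) (Fin n) k)⁻¹ := by
      simp [Matrix.coe_units_inv]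
    rw [Set.mem_setOf_eq] at ha ⊢
    rw [levi_mem_iff] at ha ⊢
    rw [h]
    haveI : Invertible (a : Matrix (Fin n) (Fin n) k) := a.invertible
    exact ⟨Matrix.blockTriangular_inv_of_blockTriangular ha.1,
      Matrix.blockTriangular_inv_of_blockTriangular ha.2⟩

end Levi
/-- The block function on `Fin n` describing two consecutive blocks, the first of size `r`. -/
def twoBlocks (n r : ℕ) : Fin n → Fin 2 := fun i => if (i : ℕ) < r then 0 else 1

section Permutations

variable {n : ℕ} {v : Equiv.Perm (Fin n)}

/-- If every descent of `v` at consecutive places has size one, then `v` is a decreasing run of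
consecutive values between the two places of any inversion. -/
lemma add_eq_of_inversion (h : ∀ i j : Fin n, (j : ℕ) = i + 1 → v j < v i → (v j : ℕ) + 1 = v i)
    (i j : Fin n) (hij : i < j) (hv : v j < v i) (m : Fin n) (him : i ≤ m) (hmj : m ≤ j) :
    (v m : ℕ) + m = v i + i := by
  obtain ⟨d, hd⟩ : ∃ d : ℕ, (j : ℕ) = i + 1 + d :=
    ⟨j - (i + 1), by have : (i : ℕ) < j := hij; omega⟩
  induction d generalizing i m with
  | zero =>
    have h1 := h i j hd hv
    have : m = i ∨ m = j := by
      rw [Fin.ext_iff, Fin.ext_iff]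
      have : (i : ℕ) ≤ m := him
      have : (m : ℕ) ≤ j := hmj
      omega
    rcases this with rfl | rfl <;> omega
  | succ d ih =>
    have hi' : (i : ℕ) + 1 < n := by have := j.2; omega
    obtain ⟨i', hi'⟩ : ∃ i' : Fin n, (i' : ℕ) = i + 1 := ⟨⟨i + 1, hi'⟩, rfl⟩
    have hij' : i' < j := by rw [Fin.lt_def]; omega
    have hne : v i' ≠ v i := fun e => by
      have := congrArg Fin.val (v.injective e); omega
    have hne' : v i' ≠ v j := fun e => by
      have := congrArg Fin.val (v.injective e); omega
    rcases lt_or_gt_of_ne hne with hlt | hgt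
    · have h1 := h i i' hi' hlt
      have h2 : v j < v i' := by
        rw [Fin.lt_def] at hv ⊢
        rw [Ne, Fin.ext_iff] at hne'
        omega
      by_cases hm : m = i
      · rw [hm]
      · have hm' : i' ≤ m := by
          rw [Fin.ext_iff] at hm
          rw [Fin.le_def] at him ⊢
          omega
        have := ih i' hij' h2 m hm' hmj (by omega)
        omega
    · exfalso
      have h2 : v j < v i' := hv.trans hgt
      have key := fun m h3 h4 => ih i' hij' h2 m h3 h4 (by omega)
      have hj := key j hij'.le le_rfl
      have hgt' : (v i : ℕ) < v i' := hgt
      have hv' : (v j : ℕ) < v i := hv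
      obtain ⟨m, hm⟩ : ∃ m : Fin n, (m : ℕ) = v i' + i' - v i := ⟨⟨v i' + i' - v i, by omega⟩, rfl⟩
      have h5 := key m (by rw [Fin.le_def]; omega) (by rw [Fin.le_def]; omega)
      have h6 : v m = v i := by rw [Fin.ext_iff]; omega
      have := congrArg Fin.val (v.injective h6)
      omega

lemma apply_apply_of_descents
    (h : ∀ i j : Fin n, (j : ℕ) = i + 1 → v j < v i → (v j : ℕ) + 1 = v i) (j : Fin n) :
    v (v j) = j := by
  rcases lt_trichotomy j (v j) with hlt | heq | hgt
  · by_cases hinv : v (v j) < v j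
    · have := add_eq_of_inversion h j (v j) hlt hinv (v j) hlt.le le_rfl
      rw [Fin.ext_iff]
      omega
    · exfalso
      have hsub : (Finset.Ici (v j)).image v ⊆ Finset.Ioi (v j) := by
        intro x hx
        obtain ⟨m, hm, rfl⟩ := Finset.mem_image.1 hx
        rw [Finset.mem_Ici] at hm
        rw [Finset.mem_Ioi]
        by_contra hcon
        have hmj : v m ≠ v j := fun e => by
          rw [v.injective e] at hm; exact absurd hlt (not_lt.2 hm)
        have hlt' : v m < v j := lt_of_le_of_ne (not_lt.1 hcon) hmj
        have h1 := add_eq_of_inversion h j m (hlt.trans_le hm) hlt' (v j) hlt.le hm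
        rw [Fin.lt_def] at hlt hinv
        omega
      have h2 := Finset.card_le_card hsub
      rw [Finset.card_image_of_injective _ v.injective, Fin.card_Ici, Fin.card_Ioi] at h2
      have := (v j).2
      omega
  · rw [← heq, ← heq]
  · by_cases hinv : v j < v (v j)
    · have := add_eq_of_inversion h (v j) j hgt hinv j hgt.le le_rfl
      rw [Fin.ext_iff]
      omega
    · exfalso
      have hsub : (Finset.Iic (v j)).image v ⊆ Finset.Iio (v j) := by
        intro x hx
        obtain ⟨m, hm, rfl⟩ := Finset.mem_image.1 hx
        rw [Finset.mem_Iic] at hm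
        rw [Finset.mem_Iio]
        by_contra hcon
        have hmj : v m ≠ v j := fun e => by
          rw [v.injective e] at hm; exact absurd hgt (not_lt.2 hm)
        have hlt' : v j < v m := lt_of_le_of_ne (not_lt.1 hcon) hmj.symm
        have h1 := add_eq_of_inversion h m j (hm.trans_lt hgt) hlt' (v j) hm hgt.le
        have h2 := add_eq_of_inversion h m j (hm.trans_lt hgt) hlt' j (hm.trans hgt.le) le_rfl
        rw [Fin.lt_def] at hgt hinv
        omega
      have h2 := Finset.card_le_card hsub
      rw [Finset.card_image_of_injective _ v.injective, Fin.card_Iic, Fin.card_Iio] at h2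
      omega

lemma eq_of_inversion {α : Type*} {t : Fin n → α}
    (h : ∀ i j : Fin n, (j : ℕ) = i + 1 → v j < v i → (v j : ℕ) + 1 = v i)
    (ht : ∀ i j : Fin n, (j : ℕ) = i + 1 → v j < v i → t i = t j)
    (i j : Fin n) (hij : i < j) (hv : v j < v i) : t i = t j := by
  have key : ∀ (d : ℕ) (m : Fin n), m ≤ j → (m : ℕ) = i + d → t i = t m := by
    intro d
    induction d with
    | zero => intro m _ hm; rw [Fin.ext (a := m) (b := i) (by omega)]
    | succ d ih =>
      intro m hmj hm
      have hm' : (i : ℕ) + d < n := by have := m.2; omega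
      have hmj' : (m : ℕ) ≤ j := hmj
      have h1 := ih ⟨i + d, hm'⟩ (by rw [Fin.le_def]; simp only; omega) rfl
      have h2 := add_eq_of_inversion h i j hij hv ⟨i + d, hm'⟩ (by rw [Fin.le_def]; simp)
        (by rw [Fin.le_def]; simp only; omega)
      have h3 := add_eq_of_inversion h i j hij hv m (by rw [Fin.le_def]; omega) hmj
      rw [h1]
      apply ht _ _ (by simp only; omega)
      rw [Fin.lt_def]
      simp only at h2
      omega
  exact key (j - i) j le_rfl (by have : (i : ℕ) < j := hij; omega)

lemma apply_eq_of_descents {α : Type*} {t : Fin n → α}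
    (h : ∀ i j : Fin n, (j : ℕ) = i + 1 → v j < v i → (v j : ℕ) + 1 = v i)
    (ht : ∀ i j : Fin n, (j : ℕ) = i + 1 → v j < v i → t i = t j) (j : Fin n) :
    t (v j) = t j := by
  have hj := apply_apply_of_descents h j
  rcases lt_trichotomy j (v j) with hlt | heq | hgt
  · exact (eq_of_inversion h ht j (v j) hlt (by rwa [hj])).symm
  · rw [← heq]
  · exact eq_of_inversion h ht (v j) j hgt (by rwa [hj])

end Permutations

section GelfandTrick

variable {R : Type} [Field R] {G : Type} [Group G] {V : Type} [AddCommGroup V] [Module R V]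

lemma IsIrreducibleRep.span_orbit {ρ : Representation R G V} (hirr : IsIrreducibleRep ρ) {v : V}
    (hv : v ≠ 0) : Submodule.span R (Set.range fun g => ρ g v) = ⊤ := by
  refine (hirr.2 _ fun g x hx => ?_).resolve_left fun h => hv ?_
  · induction hx using Submodule.span_induction with
    | mem x hx =>
      obtain ⟨h, rfl⟩ := hx
      exact Submodule.subset_span ⟨g * h, by simp⟩
    | zero => simp
    | add x y _ _ hx hy => rw [map_add]; exact add_mem hx hy
    | smul c x _ hx => rw [map_smul]; exact Submodule.smul_mem _ c hx
  · have : v ∈ Submodule.span R (Set.range fun g => ρ g v) :=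
      Submodule.subset_span ⟨1, by simp⟩
    rwa [h, Submodule.mem_bot] at this

variable {N : Subgroup G}

lemma char_mul_inv (χ : N →* R) (u : N) : χ u * χ u⁻¹ = 1 := by
  rw [← map_mul, mul_inv_cancel, map_one]

lemma inv_char_mul (χ : N →* R) (u : N) : χ u⁻¹ * χ u = 1 := by
  rw [← map_mul, inv_mul_cancel, map_one]

variable [Fintype N]

/-- The operator `∑ χ(u)⁻¹ ρ(u)` over `u ∈ N`. -/
noncomputable def charSum (ρ : Representation R G V) (χ : N →* R) : V →ₗ[R] V :=
  ∑ u : N, χ u⁻¹ • ρ u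

lemma charSum_apply (ρ : Representation R G V) (χ : N →* R) (v : V) :
    charSum ρ χ v = ∑ u : N, χ u⁻¹ • ρ u v := by
  simp [charSum, LinearMap.sum_apply]

lemma rho_charSum (ρ : Representation R G V) (χ : N →* R) (w : N) (v : V) :
    ρ w (charSum ρ χ v) = χ w • charSum ρ χ v := by
  rw [charSum_apply, map_sum, Finset.smul_sum]
  refine Fintype.sum_equiv (Equiv.mulLeft w) _ _ fun u => ?_
  rw [map_smul, smul_smul, Equiv.coe_mulLeft, _root_.mul_inv_rev, map_mul, mul_left_comm,
    char_mul_inv, mul_one, Subgroup.coe_mul, map_mul]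
  rfl

lemma charSum_rho (ρ : Representation R G V) (χ : N →* R) (w : N) (v : V) :
    charSum ρ χ (ρ w v) = χ w • charSum ρ χ v := by
  rw [charSum_apply, charSum_apply, Finset.smul_sum]
  refine Fintype.sum_equiv (Equiv.mulRight w) _ _ fun u => ?_
  rw [smul_smul, Equiv.coe_mulRight, _root_.mul_inv_rev, map_mul, ← mul_assoc, char_mul_inv,
    one_mul, Subgroup.coe_mul, map_mul]
  rfl

lemma charSum_eq_card_smul (ρ : Representation R G V) (χ : N →* R) {v : V}
    (hv : ∀ u : N, ρ u v = χ u • v) : charSum ρ χ v = (Fintype.card N : R) • v := by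
  rw [charSum_apply]
  simp only [hv, smul_smul, inv_char_mul, one_smul, Finset.sum_const, Finset.card_univ,
    Nat.cast_smul_eq_nsmul]

/-- Gelfand's trick: if an anti-involution `τ` preserves `(N, χ)` and fixes, up to elements of
`N`, the double cosets that support a `χ`-equivariant function, then `χ` occurs at most once in
an irreducible representation. -/
theorem exists_smul_of_antiInvolution [Finite G] [IsAlgClosed R] {ρ : Representation R G V}
    (hirr : IsIrreducibleRep ρ) (χ : N →* R) (hN : (Fintype.card N : R) ≠ 0)
    (τ : G → G) (hτ : Function.Involutive τ) (hmul : ∀ a b, τ (a * b) = τ b * τ a)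
    (hτN : ∀ u : N, ∃ u' : N, (u' : G) = τ u ∧ χ u' = χ u)
    (H : ∀ g, (∃ u u' : N, τ g = u * g * u' ∧ χ u * χ u' = 1) ∨
      ∃ u u' : N, (u : G) * g = g * u' ∧ χ u ≠ χ u')
    {v w : V} (hv : ∀ u : N, ρ u v = χ u • v) (hw : ∀ u : N, ρ u w = χ u • w) (hv0 : v ≠ 0) :
    ∃ c : R, w = c • v := by
  set e := charSum ρ χ with he
  have hzero : ∀ (u u' : N) (g : G), (u : G) * g = g * u' → χ u ≠ χ u' →
      ∀ x, e (ρ g (e x)) = 0 := by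
    intro u u' g hg hne x
    have h1 : e (ρ ((u : G) * g) (e x)) = χ u • e (ρ g (e x)) := by
      rw [map_mul, Module.End.mul_apply, he, charSum_rho]
    have h2 : e (ρ (g * (u' : G)) (e x)) = χ u' • e (ρ g (e x)) := by
      rw [map_mul, Module.End.mul_apply, he, rho_charSum, map_smul, map_smul]
    rw [hg, h2, ← sub_eq_zero, ← sub_smul] at h1
    exact (smul_eq_zero.1 h1).resolve_left (sub_ne_zero.2 hne.symm)
  have hfix : ∀ g x, e (ρ (τ g) (e x)) = e (ρ g (e x)) := by
    intro g x
    rcases H g with ⟨u, u', hg, hχ⟩ | ⟨u, u', hg, hne⟩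
    · rw [hg, map_mul, map_mul, Module.End.mul_apply, Module.End.mul_apply, he, charSum_rho,
        rho_charSum, map_smul, map_smul, smul_smul, hχ, one_smul]
    · rw [hzero u u' g hg hne]
      obtain ⟨t, ht, htχ⟩ := hτN u
      obtain ⟨t', ht', htχ'⟩ := hτN u'
      refine hzero t' t (τ g) ?_ (by rw [htχ, htχ']; exact hne.symm) x
      rw [ht, ht', ← hmul, ← hmul, hg]
  have hexp : ∀ g h x, e (ρ g (e (ρ h (e x)))) = ∑ u : N, χ u⁻¹ • e (ρ (g * u * h) (e x)) := by
    intro g h x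
    conv_lhs => rw [he, charSum_apply ρ χ (ρ h (charSum ρ χ x))]
    rw [map_sum, map_sum]
    refine Finset.sum_congr rfl fun u _ => ?_
    rw [map_smul, map_smul, map_mul, map_mul]
    rfl
  have hcomm : ∀ g h x, e (ρ g (e (ρ h (e x)))) = e (ρ h (e (ρ g (e x)))) := by
    intro g h x
    choose t ht htχ using hτN
    have htt : Function.Involutive t := fun u => by
      apply Subtype.ext
      rw [ht, ht, hτ]
    have hinv : ∀ u : N, χ (t u)⁻¹ = χ u⁻¹ := fun u => by
      have h1 := char_mul_inv χ (t u)
      rw [htχ, ← char_mul_inv χ u] at h1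
      refine mul_left_cancel₀ (fun h0 => ?_) h1
      have h2 := char_mul_inv χ u
      rw [h0, zero_mul] at h2
      exact zero_ne_one h2
    calc e (ρ g (e (ρ h (e x)))) = ∑ u : N, χ u⁻¹ • e (ρ (τ h * u * τ g) (e x)) := by
          rw [hexp]
          refine Fintype.sum_equiv htt.toPerm _ _ fun u => ?_
          rw [Function.Involutive.coe_toPerm, hinv, ht, mul_assoc (τ h), ← hmul, ← hmul,
            hfix, mul_assoc]
      _ = e (ρ h (e (ρ g (e x)))) := by
          rw [← hexp, hfix h, hfix g]
  have hspan : ∀ {y : V}, y ≠ 0 → ∀ x, e x ∈ Submodule.span R (Set.range fun g => e (ρ g y)) := by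
    intro y hy x
    have hx : x ∈ Submodule.span R (Set.range fun g => ρ g y) := by
      rw [hirr.span_orbit hy]; trivial
    have h1 := Submodule.mem_map_of_mem (f := e) hx
    rw [Submodule.map_span, ← Set.range_comp] at h1
    exact h1
  let W : Submodule R V :=
    { carrier := {x | ∀ u : N, ρ u x = χ u • x}
      add_mem' := fun {a b} ha hb u => by rw [map_add, ha u, hb u, smul_add]
      zero_mem' := fun u => by rw [map_zero, smul_zero]
      smul_mem' := fun c x hx u => by rw [map_smul, hx u, smul_comm] }
  have heW : ∀ x, e x ∈ W := fun x u => rho_charSum ρ χ u x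
  have hWe : ∀ x ∈ W, e x = (Fintype.card N : R) • x := fun x hx => charSum_eq_card_smul ρ χ hx
  have hcommW : ∀ g h, ∀ x ∈ W, e (ρ g (e (ρ h x))) = e (ρ h (e (ρ g x))) := by
    intro g h x hx
    have h1 := hcomm g h x
    rw [hWe x hx] at h1
    simpa only [map_smul, smul_right_inj hN] using h1
  have : Module.Finite R V := by
    refine ⟨?_⟩
    rw [← hirr.span_orbit hv0]
    exact Submodule.fg_span (Set.finite_range _)
  have : Nontrivial W := ⟨⟨⟨v, hv⟩, 0, fun h => hv0 (congrArg Subtype.val h)⟩⟩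
  have hscalar : ∀ g, ∃ μ : R, ∀ x ∈ W, e (ρ g x) = μ • x := by
    intro g
    let T : Module.End R W := (e ∘ₗ ρ g).restrict (p := W) (q := W) fun x _ => heW _
    obtain ⟨μ, hμ⟩ := Module.End.exists_eigenvalue T
    obtain ⟨y, hy⟩ := hμ.exists_hasEigenvector
    have hTy : e (ρ g y) = μ • (y : V) := congrArg Subtype.val hy.apply_eq_smul
    have hy0 : (y : V) ≠ 0 := fun h => hy.2 (Subtype.ext h)
    have hex : ∀ x, e (ρ g (e x)) = μ • e x := by
      intro x
      have h1 := hspan hy0 x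
      generalize e x = z at h1 ⊢
      induction h1 using Submodule.span_induction with
      | mem z hz =>
        obtain ⟨h, rfl⟩ := hz
        simp only
        rw [hcommW g h y y.2, hTy, map_smul, map_smul]
      | zero => simp
      | add a b _ _ ha hb => rw [map_add, map_add, ha, hb, smul_add]
      | smul c a _ ha => rw [map_smul, map_smul, ha, smul_comm]
    refine ⟨μ, fun x hx => ?_⟩
    have h1 := hex x
    rw [hWe x hx, map_smul, map_smul, smul_comm] at h1
    exact (smul_right_inj hN).1 h1
  have h1 := hspan hv0 w
  have h2 : Submodule.span R (Set.range fun g => e (ρ g v)) ≤ Submodule.span R {v} := by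
    rw [Submodule.span_le]
    rintro _ ⟨g, rfl⟩
    obtain ⟨μ, hμ⟩ := hscalar g
    exact Submodule.mem_span_singleton.2 ⟨μ, (hμ v hv).symm⟩
  obtain ⟨c, hc⟩ := Submodule.mem_span_singleton.1 (h2 h1)
  rw [hWe w hw] at hc
  refine ⟨(Fintype.card N : R)⁻¹ * c, ?_⟩
  rw [mul_smul, hc, smul_smul, inv_mul_cancel₀ hN, one_smul]

end GelfandTrick

section AdditiveCharacter

lemma exists_addChar_ne_one (k : Type) [Field k] [Finite k] (R : Type) [Field R] [IsAlgClosed R]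
    (h : ringChar R ≠ ringChar k) : ∃ ψ : AddChar k R, ∃ x, ψ x ≠ 1 := by
  let χ := AddChar.FiniteField.primitiveChar k R h
  have : FiniteDimensional R (CyclotomicField χ.n R) :=
    inferInstanceAs (FiniteDimensional R (Polynomial.cyclotomic χ.n R).SplittingField)
  let f : CyclotomicField χ.n R →ₐ[R] R := IsAlgClosed.lift
  refine ⟨(f : CyclotomicField χ.n R →* R).compAddChar χ.char, ?_⟩
  obtain ⟨x, hx⟩ := AddChar.ne_one_iff.1 (χ.prim one_ne_zero)
  refine ⟨x, fun hx' => hx ?_⟩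
  rw [AddChar.mulShift_apply, one_mul]
  refine f.toRingHom.injective ?_
  rw [map_one]
  exact hx'

lemma exists_addChar_mul_ne {k R : Type} [Field k] [Field R] {ψ : AddChar k R}
    (hψ : ∃ x, ψ x ≠ 1) {a b : k} (hab : a ≠ b) : ∃ x, ψ (x * a) ≠ ψ (x * b) := by
  obtain ⟨x, hx⟩ := hψ
  refine ⟨x / (a - b), fun h => hx ?_⟩
  have h1 : x = x / (a - b) * a - x / (a - b) * b := by
    rw [← mul_sub, div_mul_cancel₀ _ (sub_ne_zero.2 hab)]
  rw [h1, AddChar.map_sub_eq_div, h]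
  exact div_self (ψ.val_isUnit _).ne_zero

end AdditiveCharacter

section Unipotent

variable {n : ℕ} {k : Type} [Field k]

/-- The element `1 + x yᵀ` of `GL n k`, for `yᵀ x = 0`. -/
def oneAddVecMulVec (x y : Fin n → k) (h : y ⬝ᵥ x = 0) : GL (Fin n) k where
  val := 1 + vecMulVec x y
  inv := 1 - vecMulVec x y
  val_inv := by
    have h' := vecMulVec_mul_vecMulVec x y x y
    rw [h, zero_smul, vecMulVec_zero] at h'
    rw [add_mul, mul_sub, mul_sub, h']
    simp
  inv_val := by
    have h' := vecMulVec_mul_vecMulVec x y x y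
    rw [h, zero_smul, vecMulVec_zero] at h'
    rw [sub_mul, mul_add, mul_add, h']
    simp

/-- The upper unitriangular matrices that differ from the identity only in columns `≥ m`. -/
def IsUnip (m : ℕ) (M : Matrix (Fin n) (Fin n) k) : Prop :=
  ∀ i j : Fin n, j ≤ i ∨ (j : ℕ) < m → M i j = (1 : Matrix (Fin n) (Fin n) k) i j

lemma IsUnip.mul_apply {m : ℕ} {A B : Matrix (Fin n) (Fin n) k} (hA : IsUnip m A)
    (hB : IsUnip m B) (i j : Fin n) (hij : j ≤ i ∨ (j : ℕ) < m) :
    (A * B) i j = (1 : Matrix (Fin n) (Fin n) k) i j := by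
  rw [Matrix.mul_apply, ← hA i j hij, ← Matrix.mul_one A, Matrix.mul_apply, Matrix.mul_one]
  refine Finset.sum_congr rfl fun l _ => ?_
  rcases le_or_gt j l with hl | hl
  · rw [hB l j (Or.inl hl)]
  · rcases hij with hij | hij
    · rw [hA i l (Or.inl (hl.le.trans hij)), Matrix.one_apply_ne (hl.trans_le hij).ne', zero_mul,
        zero_mul]
    · rw [hB l j (Or.inr hij)]

/-- The subgroup of elements of `GL n k` satisfying `IsUnip m`. -/
def unip (n : ℕ) (k : Type) [Field k] [Finite k] (m : ℕ) : Subgroup (GL (Fin n) k) :=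
  let S : Submonoid (GL (Fin n) k) :=
    { carrier := {g | IsUnip m g.val}
      mul_mem' := fun {a b} ha hb => IsUnip.mul_apply (A := a.val) (B := b.val) ha hb
      one_mem' := fun _ _ _ => rfl }
  { S with
    inv_mem' := fun {g} hg => by
      have h : g⁻¹ ∈ Submonoid.powers g :=
        mem_powers_iff_mem_zpowers.2 (inv_mem (Subgroup.mem_zpowers g))
      exact (Submonoid.powers_le (P := S)).2 hg h }

/-- The sum of the entries just above the diagonal. -/
def superSum (M : Matrix (Fin n) (Fin n) k) : k :=
  ∑ i : Fin n, ∑ j : Fin n, if (j : ℕ) = i + 1 then M i j else 0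

lemma superSum_one : superSum (1 : Matrix (Fin n) (Fin n) k) = 0 := by
  refine Finset.sum_eq_zero fun i _ => Finset.sum_eq_zero fun j _ => ?_
  split_ifs with h
  · exact Matrix.one_apply_ne fun e => by rw [e] at h; omega
  · rfl

lemma superSum_add (A B : Matrix (Fin n) (Fin n) k) :
    superSum (A + B) = superSum A + superSum B := by
  simp only [superSum, ← Finset.sum_add_distrib]
  refine Finset.sum_congr rfl fun i _ => Finset.sum_congr rfl fun j _ => ?_
  split_ifs <;> simp

lemma superSum_congr {A B : Matrix (Fin n) (Fin n) k}
    (h : ∀ i j : Fin n, (j : ℕ) = i + 1 → A i j = B i j) : superSum A = superSum B := by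
  refine Finset.sum_congr rfl fun i _ => Finset.sum_congr rfl fun j _ => ?_
  split_ifs with hij
  · exact h i j hij
  · rfl

lemma superSum_mul {A B : Matrix (Fin n) (Fin n) k} (hA : IsUnip 0 A) (hB : IsUnip 0 B) :
    superSum (A * B) = superSum A + superSum B := by
  rw [← superSum_add]
  refine superSum_congr fun i j hij => ?_
  have hne : i ≠ j := fun e => by rw [e] at hij; omega
  rw [Matrix.add_apply, Matrix.mul_apply]
  have h1 : ∀ l, A i l * B l j = (if l = i then B l j else 0) + if l = j then A i l else 0 := by
    intro l
    rcases le_or_gt l i with hl | hl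
    · have hlj : l ≠ j := fun e => by rw [e, Fin.le_def] at hl; omega
      rw [hA i l (Or.inl hl), if_neg hlj, Matrix.one_apply]
      by_cases h : l = i <;> simp [h, Ne.symm]
    · have hjl : j ≤ l := by rw [Fin.le_def]; rw [Fin.lt_def] at hl; omega
      rw [hB l j (Or.inl hjl), if_neg hl.ne', Matrix.one_apply]
      by_cases h : l = j <;> simp [h]
  simp only [h1, Finset.sum_add_distrib, Finset.sum_ite_eq', Finset.mem_univ, if_true]
  ring

lemma superSum_vecMulVec_single (x : Fin n → k) (i j : Fin n) (hij : (j : ℕ) = i + 1) :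
    superSum (vecMulVec x (Pi.single j 1)) = x i := by
  rw [superSum, Finset.sum_eq_single i, Finset.sum_eq_single j]
  · simp [hij, vecMulVec_apply]
  · intro b _ hb
    simp [vecMulVec_apply, hb]
  · simp
  · intro b _ hb
    refine Finset.sum_eq_zero fun l _ => ?_
    split_ifs with h
    · have : l ≠ j := fun e => hb (Fin.ext (by rw [e] at h; omega))
      simp [vecMulVec_apply, this]
    · rfl
  · simp

/-- The character of the upper unitriangular group attached to an additive character. -/
def unipChar {R : Type} [Field R] [Finite k] (ψ : AddChar k R) : unip n k 0 →* R where
  toFun u := ψ (superSum u.1.val)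
  map_one' := by
    change ψ (superSum (1 : Matrix (Fin n) (Fin n) k)) = 1
    rw [superSum_one, AddChar.map_zero_eq_one]
  map_mul' a b := by
    change ψ (superSum (a.1.val * b.1.val)) = _
    rw [superSum_mul a.2 b.2, AddChar.map_add_eq_mul]

lemma card_unip_ne_zero {R : Type} [Field R] [Finite k] [Fintype (unip n k 0)]
    (hk : (Nat.card k : R) ≠ 0) : (Fintype.card (unip n k 0) : R) ≠ 0 := by
  let M (f : {q : Fin n × Fin n // q.1 < q.2} → k) : Matrix (Fin n) (Fin n) k := fun i j =>
    if h : i < j then f ⟨(i, j), h⟩ else (1 : Matrix (Fin n) (Fin n) k) i j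
  have hM : ∀ f, (M f).det ≠ 0 := by
    intro f
    have : (M f).BlockTriangular id := fun i j (h : j < i) => by
      simp [M, h.not_gt, h.ne']
    rw [Matrix.det_of_isUpperTriangular this]
    simp [M]
  let e : unip n k 0 ≃ ({q : Fin n × Fin n // q.1 < q.2} → k) :=
    { toFun := fun u q => u.1.val q.1.1 q.1.2
      invFun := fun f => ⟨GeneralLinearGroup.mkOfDetNeZero (M f) (hM f), fun i j hij => by
        have : ¬ i < j := by
          rcases hij with h | h
          · exact h.not_gt
          · exact absurd h (Nat.not_lt_zero _)
        change M f i j = _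
        simp [M, this]⟩
      left_inv := fun u => by
        apply Subtype.ext
        apply Units.ext
        ext i j
        change M (fun q => u.1.val q.1.1 q.1.2) i j = _
        by_cases h : i < j
        · simp [M, h]
        · simp only [M, h, dif_neg, not_false_eq_true]
          exact (u.2 i j (Or.inl (not_lt.1 h))).symm
      right_inv := fun f => by
        funext ⟨⟨i, j⟩, h⟩
        change M f i j = _
        simp only at h
        simp [M, h] }
  rw [← Nat.card_eq_fintype_card, Nat.card_congr e, Nat.card_fun, Nat.cast_pow]
  exact pow_ne_zero _ hk

end Unipotent

section Bruhat

variable {n : ℕ} {k : Type} [Field k]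

lemma oneAddVecMulVec_mul_apply (x y : Fin n → k) (h : y ⬝ᵥ x = 0) (M : Matrix (Fin n) (Fin n) k)
    (i j : Fin n) : ((oneAddVecMulVec x y h).val * M) i j = M i j + x i * (y ᵥ* M) j := by
  change ((1 + vecMulVec x y) * M) i j = _
  rw [add_mul, one_mul, vecMulVec_mul, Matrix.add_apply, vecMulVec_apply]

lemma mul_oneAddVecMulVec_apply (x y : Fin n → k) (h : y ⬝ᵥ x = 0) (M : Matrix (Fin n) (Fin n) k)
    (i j : Fin n) : (M * (oneAddVecMulVec x y h).val) i j = M i j + (M *ᵥ x) i * y j := by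
  change (M * (1 + vecMulVec x y)) i j = _
  rw [mul_add, mul_one, mul_vecMulVec, Matrix.add_apply, vecMulVec_apply]

lemma oneAddVecMulVec_apply (x y : Fin n → k) (h : y ⬝ᵥ x = 0) (i j : Fin n) :
    (oneAddVecMulVec x y h).val i j = (1 : Matrix (Fin n) (Fin n) k) i j + x i * y j := rfl

lemma oneAddVecMulVec_mem_unip [Finite k] {x y : Fin n → k} (h : y ⬝ᵥ x = 0) {m : ℕ}
    (hxy : ∀ i j : Fin n, j ≤ i ∨ (j : ℕ) < m → x i * y j = 0) :
    oneAddVecMulVec x y h ∈ unip n k m := fun i j hij => by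
  rw [oneAddVecMulVec_apply, hxy i j hij, add_zero]

/-- The row `r` and the column `c` of `M` contain exactly one nonzero entry, at `(r, c)`. -/
def IsPivot (M : Matrix (Fin n) (Fin n) k) (r c : Fin n) : Prop :=
  M r c ≠ 0 ∧ (∀ r', r' ≠ r → M r' c = 0) ∧ ∀ c', c' ≠ c → M r c' = 0

lemma exists_isPivot [Finite k] (g : GL (Fin n) k) (c : Fin n)
    (hg : ∀ s < c, ∃ r, IsPivot g.val r s) :
    ∃ u ∈ unip n k 0, ∃ u' ∈ unip n k 0, ∀ s ≤ c, ∃ r, IsPivot (u * g * u').val r s := by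
  classical
  have hcol : (Finset.univ.filter fun i => g.val i c ≠ 0).Nonempty := by
    by_contra hemp
    rw [Finset.not_nonempty_iff_eq_empty, Finset.filter_eq_empty_iff] at hemp
    have h0 : g.val *ᵥ Pi.single c 1 = 0 := by
      ext i
      simpa using hemp (Finset.mem_univ i)
    have h1 : (g⁻¹).val *ᵥ (g.val *ᵥ Pi.single c 1) = Pi.single c 1 := by
      rw [Matrix.mulVec_mulVec, ← Units.val_mul, inv_mul_cancel, Units.val_one, Matrix.one_mulVec]
    rw [h0, Matrix.mulVec_zero] at h1
    have := congrFun h1 c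
    simp at this
  obtain ⟨i, hi, hmax⟩ := Finset.exists_max_image _ id hcol
  rw [Finset.mem_filter] at hi
  have hi := hi.2
  have hmax : ∀ r, i < r → g.val r c = 0 := fun r hr => by
    by_contra h
    exact absurd (hmax r (by simpa using h)) (not_le.2 hr)
  set x : Fin n → k := fun r => if r < i then - (g.val r c / g.val i c) else 0 with hx
  have hx' : (Pi.single i 1 : Fin n → k) ⬝ᵥ x = 0 := by simp [hx]
  set z : Fin n → k := fun s => if c < s then - (g.val i s / g.val i c) else 0 with hz
  have hz' : z ⬝ᵥ (Pi.single c 1 : Fin n → k) = 0 := by simp [hz]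
  set u := oneAddVecMulVec x (Pi.single i 1) hx' with hu
  set u' := oneAddVecMulVec (Pi.single c 1) z hz' with hu'
  have hval : ∀ r s, (u * g * u').val r s
      = g.val r s + x r * g.val i s + (g.val r c + x r * g.val i c) * z s := by
    intro r s
    rw [Units.val_mul, hu', mul_oneAddVecMulVec_apply, Matrix.mulVec_single_one, Matrix.col_apply,
      Units.val_mul, hu, oneAddVecMulVec_mul_apply, oneAddVecMulVec_mul_apply,
      Matrix.single_one_vecMul, Matrix.row_apply, Matrix.row_apply]
  have hclear : ∀ r, r ≠ i → g.val r c + x r * g.val i c = 0 := by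
    intro r hr
    rcases lt_or_gt_of_ne hr with hlt | hgt
    · simp only [hx, hlt, if_true]
      field_simp
      ring
    · simp [hx, hgt.not_gt, hmax r hgt]
  have hxi : x i = 0 := by simp [hx]
  have hzc : ∀ s, s ≤ c → z s = 0 := fun s hs => by simp [hz, hs.not_gt]
  refine ⟨u, oneAddVecMulVec_mem_unip _ ?_, u', oneAddVecMulVec_mem_unip _ ?_, ?_⟩
  · rintro r s (hsr | hsr)
    · by_cases h : s = i
      · subst h; simp [hx, hsr.not_gt]
      · simp [h]
    · exact absurd hsr (Nat.not_lt_zero _)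
  · rintro r s (hsr | hsr)
    · by_cases h : r = c
      · subst h; simp [hz, hsr.not_gt]
      · simp [h]
    · exact absurd hsr (Nat.not_lt_zero _)
  · intro s hs
    rcases hs.lt_or_eq with hs' | rfl
    · obtain ⟨r, h1, h2, h3⟩ := hg s hs'
      have hrc := h3 c hs'.ne'
      have hri : i ≠ r := fun e => hi (by rw [e, hrc])
      have his := h2 i hri
      have hxr : x r = 0 := by simp [hx, hrc]
      refine ⟨r, ?_, fun r' hr' => ?_, fun s' hs' => ?_⟩
      · rw [hval, hxr, hzc s hs]; simpa using h1
      · rw [hval, his, hzc s hs, h2 r' hr']; ring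
      · rw [hval, hxr, hrc, h3 s' hs']; ring
    · refine ⟨i, ?_, fun r' hr' => ?_, fun s' hs' => ?_⟩
      · rw [hval, hxi, hzc s le_rfl]; simpa using hi
      · rw [hval, hclear r' hr']; ring
      · rw [hval, hxi]
        rcases lt_or_gt_of_ne hs' with hlt | hgt
        · obtain ⟨r, h1, h2, h3⟩ := hg s' hlt
          have hri : i ≠ r := fun e => hi (by rw [e, h3 s hlt.ne'])
          rw [hzc s' hlt.le, h2 i hri]; ring
        · simp only [hz, hgt, if_true]
          field_simp
          ring

/-- The Bruhat decomposition: every double coset of the upper unitriangular group contains a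
monomial matrix. -/
theorem exists_forall_isPivot [Finite k] (g : GL (Fin n) k) :
    ∃ u ∈ unip n k 0, ∃ u' ∈ unip n k 0, ∀ s, ∃ r, IsPivot (u * g * u').val r s := by
  suffices H : ∀ d : ℕ, ∃ u ∈ unip n k 0, ∃ u' ∈ unip n k 0,
      ∀ s : Fin n, (s : ℕ) < d → ∃ r, IsPivot (u * g * u').val r s by
    obtain ⟨u, hu, u', hu', h⟩ := H n
    exact ⟨u, hu, u', hu', fun s => h s s.2⟩
  intro d
  induction d with
  | zero => exact ⟨1, one_mem _, 1, one_mem _, fun s hs => absurd hs (Nat.not_lt_zero _)⟩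
  | succ d ih =>
    obtain ⟨u, hu, u', hu', h⟩ := ih
    by_cases hd : d < n
    · obtain ⟨w, hw, w', hw', h'⟩ := exists_isPivot (u * g * u') ⟨d, hd⟩ fun s hs => h s hs
      refine ⟨w * u, mul_mem hw hu, u' * w', mul_mem hu' hw', fun s hs => ?_⟩
      have := h' s (Nat.lt_succ_iff.1 hs)
      simpa only [mul_assoc] using this
    · exact ⟨u, hu, u', hu', fun s _ => h s (by have := s.2; omega)⟩

end Bruhat

section Whittaker

variable {n : ℕ} {k : Type} [Field k]

/-- Transposition along the antidiagonal. -/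
def antiTr (M : Matrix (Fin n) (Fin n) k) : Matrix (Fin n) (Fin n) k := fun i j => M j.rev i.rev

lemma antiTr_one : antiTr (1 : Matrix (Fin n) (Fin n) k) = 1 := by
  ext i j
  simp [antiTr, Matrix.one_apply, eq_comm]

lemma antiTr_mul (A B : Matrix (Fin n) (Fin n) k) : antiTr (A * B) = antiTr B * antiTr A := by
  ext i j
  rw [antiTr, Matrix.mul_apply, Matrix.mul_apply]
  refine Fintype.sum_equiv Fin.revPerm _ _ fun l => ?_
  simp [antiTr, mul_comm]

/-- Transposition along the antidiagonal, as an anti-involution of `GL n k`. -/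
def antiTrUnits (g : GL (Fin n) k) : GL (Fin n) k where
  val := antiTr g.val
  inv := antiTr g⁻¹.val
  val_inv := by rw [← antiTr_mul, ← Units.val_mul, inv_mul_cancel, Units.val_one, antiTr_one]
  inv_val := by rw [← antiTr_mul, ← Units.val_mul, mul_inv_cancel, Units.val_one, antiTr_one]

lemma antiTrUnits_involutive : Function.Involutive (antiTrUnits (n := n) (k := k)) := by
  intro g
  apply Units.ext
  ext i j
  change g.val i.rev.rev j.rev.rev = _
  rw [Fin.rev_rev, Fin.rev_rev]

lemma antiTrUnits_mul (a b : GL (Fin n) k) :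
    antiTrUnits (a * b) = antiTrUnits b * antiTrUnits a :=
  Units.ext (antiTr_mul a.val b.val)

lemma antiTrUnits_mem_unip [Finite k] {u : GL (Fin n) k} (hu : u ∈ unip n k 0) :
    antiTrUnits u ∈ unip n k 0 := by
  intro i j hij
  have hij : j ≤ i := hij.resolve_right (Nat.not_lt_zero _)
  change u.val j.rev i.rev = _
  rw [hu j.rev i.rev (Or.inl (Fin.rev_le_rev.2 hij))]
  simp [Matrix.one_apply, eq_comm]

lemma superSum_antiTr (M : Matrix (Fin n) (Fin n) k) : superSum (antiTr M) = superSum M := by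
  rw [superSum, superSum, Finset.sum_comm]
  refine Fintype.sum_equiv Fin.revPerm _ _ fun i => Fintype.sum_equiv Fin.revPerm _ _ fun j => ?_
  simp only [Fin.revPerm_apply, antiTr]
  congr 1
  rw [Fin.val_rev, Fin.val_rev]
  apply propext
  have := i.2
  have := j.2
  omega

lemma monomial_mul_oneAdd {m : GL (Fin n) k} {w : Fin n → Fin n}
    (hw : ∀ c, IsPivot m.val (w c) c) (i j : Fin n) (x : k) (h h') :
    oneAddVecMulVec (Pi.single (w i) (x * m.val (w i) i)) (Pi.single (w j) 1) h * m =
      m * oneAddVecMulVec (Pi.single i (x * m.val (w j) j)) (Pi.single j 1) h' := by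
  apply Units.ext
  ext r s
  rw [Units.val_mul, Units.val_mul, oneAddVecMulVec_mul_apply, mul_oneAddVecMulVec_apply,
    Matrix.single_one_vecMul, Matrix.row_apply, Matrix.mulVec_single, Pi.smul_apply,
    Matrix.col_apply]
  congr 1
  by_cases hr : r = w i
  · subst hr
    by_cases hs : s = j
    · subst hs
      simp
      ring
    · simp [hs, (hw j).2.2 s hs]
  · simp [hr, (hw i).2.1 r hr]

lemma antiTrUnits_eq_of_isPivot {m : GL (Fin n) k} {w : Fin n → Fin n}
    (hw : ∀ c, IsPivot m.val (w c) c)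
    (hdesc : ∀ i j : Fin n, (j : ℕ) = i + 1 → w i < w j →
      (w j : ℕ) = w i + 1 ∧ m.val (w i) i = m.val (w j) j) : antiTrUnits m = m := by
  have hinj : Function.Injective w := by
    intro c c' h
    by_contra hne
    refine (hw c').1 ?_
    rw [← h]
    exact (hw c).2.2 c' (Ne.symm hne)
  have hval : ∀ i j, m.val i j = if i = w j then m.val (w j) j else 0 := by
    intro i j
    split_ifs with h
    · rw [h]
    · exact (hw j).2.1 i h
  let v : Equiv.Perm (Fin n) := (Equiv.ofBijective w hinj.bijective_of_finite).trans Fin.revPerm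
  have hv : ∀ i, v i = (w i).rev := fun _ => rfl
  have h1 : ∀ i j : Fin n, (j : ℕ) = i + 1 → v j < v i → (v j : ℕ) + 1 = v i := by
    intro i j hij hlt
    rw [hv, hv, Fin.rev_lt_rev] at hlt
    have := (hdesc i j hij hlt).1
    rw [hv, hv, Fin.val_rev, Fin.val_rev]
    have := (w j).2
    omega
  have h2 : ∀ i j : Fin n, (j : ℕ) = i + 1 → v j < v i → m.val (w i) i = m.val (w j) j := by
    intro i j hij hlt
    rw [hv, hv, Fin.rev_lt_rev] at hlt
    exact (hdesc i j hij hlt).2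
  have hvv := apply_apply_of_descents h1
  have htv := apply_eq_of_descents (t := fun i => m.val (w i) i) h1 h2
  apply Units.ext
  ext i j
  change m.val j.rev i.rev = _
  rw [hval, hval i j]
  have hiff : j.rev = w i.rev ↔ i = w j := by
    constructor
    · intro h
      have : j = v i.rev := by rw [hv, ← h, Fin.rev_rev]
      have h3 := hvv i.rev
      rw [← this, hv] at h3
      exact (Fin.rev_injective h3).symm
    · intro h
      have : i.rev = v j := by rw [hv, h]
      rw [this, ← Fin.rev_inj, Fin.rev_rev, ← hv, hvv]
  by_cases h : i = w j
  · have : i.rev = v j := by rw [hv, h]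
    rw [if_pos h, if_pos (hiff.2 h), this]
    exact htv j
  · rw [if_neg h, if_neg (mt hiff.1 h)]

lemma superSum_oneAdd_single (i j : Fin n) (x : k) (h) :
    superSum (oneAddVecMulVec (Pi.single i x) (Pi.single j 1) h).val
      = if (j : ℕ) = i + 1 then x else 0 := by
  change superSum (1 + vecMulVec _ _) = _
  rw [superSum_add, superSum_one, zero_add]
  split_ifs with hij
  · rw [superSum_vecMulVec_single _ i j hij, Pi.single_eq_same]
  · refine Finset.sum_eq_zero fun a _ => Finset.sum_eq_zero fun b _ => ?_
    split_ifs with hab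
    · rw [vecMulVec_apply]
      by_cases ha : a = i
      · have : b ≠ j := fun hb => hij (by rw [← ha, ← hb, hab])
        simp [this]
      · simp [ha]
    · rfl

lemma oneAdd_single_mem_unip [Finite k] {i j : Fin n} (hij : i < j) (x : k) (h) :
    oneAddVecMulVec (Pi.single i x) (Pi.single j 1) h ∈ unip n k 0 := by
  refine oneAddVecMulVec_mem_unip h ?_
  rintro a b (hab | hab)
  · by_cases ha : a = i
    · have : b ≠ j := fun hb => by rw [ha, hb] at hab; exact absurd hij (not_lt.2 hab)
      simp [this]
    · simp [ha]
  · exact absurd hab (Nat.not_lt_zero _)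

variable {R : Type} [Field R] [Finite k]

lemma antiTrUnits_monomial {ψ : AddChar k R} (hψ : ∃ x, ψ x ≠ 1) {m : GL (Fin n) k}
    (hm : ∀ s, ∃ r, IsPivot m.val r s) :
    antiTrUnits m = m ∨
      ∃ u u' : unip n k 0, (u : GL (Fin n) k) * m = m * u' ∧ unipChar ψ u ≠ unipChar ψ u' := by
  choose w hw using hm
  by_cases H : ∀ i j : Fin n, (j : ℕ) = i + 1 → w i < w j →
      (w j : ℕ) = w i + 1 ∧ m.val (w i) i = m.val (w j) j
  · exact Or.inl (antiTrUnits_eq_of_isPivot hw H)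
  · right
    push Not at H
    obtain ⟨i, j, hij, hlt, H⟩ := H
    have hij' : i < j := by rw [Fin.lt_def]; omega
    have hex : ∃ x : k, ψ (if (w j : ℕ) = w i + 1 then x * m.val (w i) i else 0)
        ≠ ψ (x * m.val (w j) j) := by
      split_ifs with h
      · exact exists_addChar_mul_ne hψ (H h)
      · obtain ⟨x, hx⟩ := exists_addChar_mul_ne hψ (hw j).1.symm
        exact ⟨x, by rwa [mul_zero] at hx⟩
    obtain ⟨x, hx⟩ := hex
    have h1 : (Pi.single (w j) 1 : Fin n → k) ⬝ᵥ Pi.single (w i) (x * m.val (w i) i) = 0 := by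
      simp [hlt.ne]
    have h2 : (Pi.single j 1 : Fin n → k) ⬝ᵥ Pi.single i (x * m.val (w j) j) = 0 := by
      simp [hij'.ne]
    refine ⟨⟨_, oneAdd_single_mem_unip hlt _ h1⟩, ⟨_, oneAdd_single_mem_unip hij' _ h2⟩,
      monomial_mul_oneAdd hw i j x h1 h2, ?_⟩
    change ψ (superSum _) ≠ ψ (superSum _)
    rw [superSum_oneAdd_single, superSum_oneAdd_single, if_pos hij]
    exact hx

/-- Uniqueness of Whittaker vectors in irreducible representations of `GL n k`. -/
theorem whittaker_unique [IsAlgClosed R] {V : Type} [AddCommGroup V] [Module R V]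
    {ρ : Representation R (GL (Fin n) k) V} (hirr : IsIrreducibleRep ρ)
    {ψ : AddChar k R} (hψ : ∃ x, ψ x ≠ 1) (hk : (Nat.card k : R) ≠ 0) {v w : V}
    (hv : ∀ u ∈ unip n k 0, ρ u v = ψ (superSum u.val) • v)
    (hw : ∀ u ∈ unip n k 0, ρ u w = ψ (superSum u.val) • w) (hv0 : v ≠ 0) :
    ∃ c : R, w = c • v := by
  classical
  have := Fintype.ofFinite (unip n k 0)
  refine exists_smul_of_antiInvolution hirr (unipChar ψ) (card_unip_ne_zero hk) antiTrUnits
    antiTrUnits_involutive antiTrUnits_mul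
    (fun u => ⟨⟨_, antiTrUnits_mem_unip u.2⟩, rfl, congrArg ψ (superSum_antiTr u.1.val)⟩) ?_
    (fun u => hv u u.2) (fun u => hw u u.2) hv0
  intro g
  obtain ⟨u, hu, u', hu', hm⟩ := exists_forall_isPivot g
  rcases antiTrUnits_monomial hψ hm with h | ⟨a, b, hab, hne⟩
  · left
    rw [antiTrUnits_mul, antiTrUnits_mul] at h
    let U : unip n k 0 := ⟨u, hu⟩
    let U' : unip n k 0 := ⟨u', hu'⟩
    let T : unip n k 0 := ⟨_, antiTrUnits_mem_unip hu⟩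
    let T' : unip n k 0 := ⟨_, antiTrUnits_mem_unip hu'⟩
    have hT : unipChar ψ T = unipChar ψ U := congrArg ψ (superSum_antiTr u.val)
    have hT' : unipChar ψ T' = unipChar ψ U' := congrArg ψ (superSum_antiTr u'.val)
    refine ⟨T'⁻¹ * U, U' * T⁻¹, ?_, ?_⟩
    · change _ = (antiTrUnits u')⁻¹ * u * g * (u' * (antiTrUnits u)⁻¹)
      have h1 : antiTrUnits g = (antiTrUnits u')⁻¹ *
          (antiTrUnits u' * (antiTrUnits g * antiTrUnits u)) * (antiTrUnits u)⁻¹ := by group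
      rw [h1, h]
      group
    · calc unipChar ψ (T'⁻¹ * U) * unipChar ψ (U' * T⁻¹)
          = (unipChar ψ T' * unipChar ψ T'⁻¹) * (unipChar ψ T * unipChar ψ T⁻¹) := by
            rw [map_mul, map_mul, ← hT, ← hT']; ring
        _ = 1 := by rw [char_mul_inv, char_mul_inv, one_mul]
  · right
    let U : unip n k 0 := ⟨u, hu⟩
    let U' : unip n k 0 := ⟨u', hu'⟩
    refine ⟨U⁻¹ * a * U, U' * b * U'⁻¹, ?_, ?_⟩
    · change u⁻¹ * a * u * g = g * (u' * b * u'⁻¹)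
      have : (a : GL (Fin n) k) * u * g = u * g * u' * b * u'⁻¹ := by
        rw [← hab]; group
      rw [mul_assoc, mul_assoc, ← mul_assoc (a : GL (Fin n) k), this]
      group
    · rw [map_mul, map_mul, map_mul, map_mul, mul_comm (unipChar ψ U⁻¹), mul_assoc,
        inv_char_mul, mul_one, mul_comm (unipChar ψ U'), mul_assoc, char_mul_inv, mul_one]
      exact hne

end Whittaker

section FourierDecomposition

variable {k : Type} [Field k] [Fintype k] {R : Type} [Field R] {n : ℕ}
  {G : Type} [Group G] {V : Type} [AddCommGroup V] [Module R V]

/-- The (unnormalised) projection of `v` to the eigenspace of character `z ↦ ψ (y ⬝ᵥ z)` under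
a homomorphism `a` from `kⁿ`. -/
noncomputable def fourierPart (ρ : Representation R G V) (ψ : AddChar k R) (a : (Fin n → k) → G)
    (v : V) (y : Fin n → k) : V :=
  ∑ z : Fin n → k, ψ (-(y ⬝ᵥ z)) • ρ (a z) v

lemma rho_fourierPart (ρ : Representation R G V) (ψ : AddChar k R) {a : (Fin n → k) → G}
    (ha : ∀ z z', a (z + z') = a z * a z') (v : V) (y z : Fin n → k) :
    ρ (a z) (fourierPart ρ ψ a v y) = ψ (y ⬝ᵥ z) • fourierPart ρ ψ a v y := by
  rw [fourierPart, map_sum, Finset.smul_sum]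
  refine Fintype.sum_equiv (Equiv.addLeft z) _ _ fun z' => ?_
  rw [map_smul, smul_smul, Equiv.coe_addLeft, ← AddChar.map_add_eq_mul, ha, map_mul,
    dotProduct_add, neg_add, add_neg_cancel_left]
  rfl

lemma sum_addChar_dotProduct {ψ : AddChar k R} (hψ : ∃ x, ψ x ≠ 1) {z : Fin n → k} (hz : z ≠ 0) :
    ∑ y : Fin n → k, ψ (-(y ⬝ᵥ z)) = 0 := by
  obtain ⟨i, hi⟩ := Function.ne_iff.1 hz
  obtain ⟨x, hx⟩ := exists_addChar_mul_ne hψ (neg_ne_zero.2 hi)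
  let χ : AddChar (Fin n → k) R :=
    { toFun := fun y => ψ (-(y ⬝ᵥ z))
      map_zero_eq_one' := by rw [zero_dotProduct, neg_zero, AddChar.map_zero_eq_one]
      map_add_eq_mul' := fun a b => by
        rw [add_dotProduct, neg_add, AddChar.map_add_eq_mul] }
  refine AddChar.sum_eq_zero_of_ne_one (ψ := χ) (AddChar.ne_one_iff.2 ⟨Pi.single i x, ?_⟩)
  change ψ (-(Pi.single i x ⬝ᵥ z)) ≠ 1
  rw [single_dotProduct, ← mul_neg]
  simpa using hx

lemma sum_fourierPart (ρ : Representation R G V) {ψ : AddChar k R} (hψ : ∃ x, ψ x ≠ 1)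
    {a : (Fin n → k) → G} (ha : a 0 = 1) (v : V) :
    ∑ y, fourierPart ρ ψ a v y = (Fintype.card (Fin n → k) : R) • v := by
  classical
  simp only [fourierPart]
  rw [Finset.sum_comm]
  simp only [← Finset.sum_smul]
  rw [Finset.sum_eq_single 0]
  · simp [ha, AddChar.map_zero_eq_one]
  · intro z _ hz
    rw [sum_addChar_dotProduct hψ hz, zero_smul]
  · simp

end FourierDecomposition

section Descent

variable {n : ℕ} {k : Type} [Field k]

/-- The unipotent element with entries `z i`, for `i < m`, in column `m`. -/
def colUnip (m : Fin n) (z : Fin n → k) : GL (Fin n) k :=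
  oneAddVecMulVec (fun i => if i < m then z i else 0) (Pi.single m 1) (by simp)

lemma colUnip_apply (m : Fin n) (z : Fin n → k) (i j : Fin n) :
    (colUnip m z).val i j =
      (1 : Matrix (Fin n) (Fin n) k) i j + (if i < m then z i else 0) * (Pi.single m 1 : Fin n → k) j := rfl

lemma colUnip_mul_apply (m : Fin n) (z : Fin n → k) (M : Matrix (Fin n) (Fin n) k) (i j : Fin n) :
    ((colUnip m z).val * M) i j = M i j + (if i < m then z i else 0) * M m j := by
  rw [colUnip, oneAddVecMulVec_mul_apply, Matrix.single_one_vecMul, Matrix.row_apply]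

lemma colUnip_add (m : Fin n) (z z' : Fin n → k) :
    colUnip m (z + z') = colUnip m z * colUnip m z' := by
  apply Units.ext
  ext i j
  rw [Units.val_mul, colUnip_mul_apply, colUnip_apply, colUnip_apply, colUnip_apply,
    if_neg (lt_irrefl m), zero_mul, add_zero, Matrix.one_apply (i := m), Pi.single_apply]
  simp only [Pi.add_apply, eq_comm (a := m)]
  split_ifs <;> ring

lemma colUnip_zero (m : Fin n) : colUnip m (0 : Fin n → k) = 1 := by
  apply Units.ext
  ext i j
  rw [colUnip_apply]
  simp

lemma superSum_colUnip {l m : Fin n} (hlm : (m : ℕ) = l + 1) (z : Fin n → k) :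
    superSum (colUnip m z).val = z l := by
  change superSum (1 + vecMulVec _ _) = _
  rw [superSum_add, superSum_one, zero_add, superSum_vecMulVec_single _ l m hlm,
    if_pos (by rw [Fin.lt_def]; omega)]

lemma inv_apply_of_row_eq_one {h : GL (Fin n) k} {i : Fin n}
    (hi : ∀ j, h.val i j = (1 : Matrix (Fin n) (Fin n) k) i j) (j : Fin n) :
    h⁻¹.val i j = (1 : Matrix (Fin n) (Fin n) k) i j := by
  have h1 : (h.val * h⁻¹.val) i j = (1 : Matrix (Fin n) (Fin n) k) i j := by
    rw [← Units.val_mul, mul_inv_cancel, Units.val_one]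
  rw [← h1, Matrix.mul_apply]
  simp [hi, Matrix.one_apply]

/-- The matrices whose rows of index `≥ m` are those of the identity matrix. -/
def RowsEqOne (m : Fin n) (h : GL (Fin n) k) : Prop :=
  ∀ i, m ≤ i → ∀ j, h.val i j = (1 : Matrix (Fin n) (Fin n) k) i j

lemma rowsEqOne_colUnip (m : Fin n) (z : Fin n → k) : RowsEqOne m (colUnip m z) := by
  intro i hi j
  rw [colUnip_apply, if_neg hi.not_gt, zero_mul, add_zero]

lemma RowsEqOne.colUnip_mul {m : Fin n} {h : GL (Fin n) k} (hh : RowsEqOne m h) (z : Fin n → k) :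
    ∃ z', colUnip m z * h = h * colUnip m z' ∧
      ∀ i < m, (h.val *ᵥ z') i = z i := by
  set t : Fin n → k := fun i => if i < m then z i else 0 with ht
  have hz' : h.val *ᵥ (h⁻¹.val *ᵥ t) = t := by
    rw [Matrix.mulVec_mulVec, ← Units.val_mul, mul_inv_cancel, Units.val_one, Matrix.one_mulVec]
  refine ⟨h⁻¹.val *ᵥ t, ?_, fun i hi => by rw [hz', ht]; simp [hi]⟩
  have hsupp : (fun i => if i < m then (h⁻¹.val *ᵥ t) i else 0) = h⁻¹.val *ᵥ t := by
    funext i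
    split_ifs with hi
    · rfl
    · have : h⁻¹.val i = (1 : Matrix (Fin n) (Fin n) k) i :=
        funext fun j => inv_apply_of_row_eq_one (hh i (not_lt.1 hi)) j
      rw [Matrix.mulVec, this]
      change _ = ((1 : Matrix (Fin n) (Fin n) k) *ᵥ t) i
      rw [Matrix.one_mulVec, ht]
      simp [hi]
  apply Units.ext
  ext i j
  rw [Units.val_mul, Units.val_mul, colUnip_mul_apply, colUnip,
    mul_oneAddVecMulVec_apply, hsupp, hz', hh m le_rfl, Matrix.one_apply, Pi.single_apply]
  simp only [eq_comm (a := m)]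
  rfl

/-- The matrices whose entries vanish at places of odd total index; they form a conjugate of the
block-diagonal Levi subgroup. -/
def EvenSupported (h : GL (Fin n) k) : Prop :=
  ∀ i j : Fin n, (i : ℕ) % 2 ≠ j % 2 → h.val i j = 0

lemma exists_rowsEqOne_row_eq {l m : Fin n} (hlm : (m : ℕ) = l + 1) {y : Fin n → k} (hy : y ≠ 0)
    (hsupp : ∀ i, m ≤ i ∨ (i : ℕ) % 2 = m % 2 → y i = 0) :
    ∃ h : GL (Fin n) k, RowsEqOne m h ∧ EvenSupported h ∧ h.val l = y := by
  obtain ⟨i₀, hi₀⟩ := Function.ne_iff.1 hy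
  have hi₀m : i₀ < m := by
    by_contra h
    exact hi₀ (hsupp i₀ (Or.inl (not_lt.1 h)))
  have hi₀p : (i₀ : ℕ) % 2 ≠ m % 2 := fun h => hi₀ (hsupp i₀ (Or.inr h))
  set M : Matrix (Fin n) (Fin n) k :=
    ((1 : Matrix (Fin n) (Fin n) k).updateRow i₀ y).submatrix (Equiv.swap i₀ l) id with hM
  have hdet : M.det ≠ 0 := by
    rw [hM, Matrix.det_permute]
    refine mul_ne_zero ?_ ?_
    · rcases Int.units_eq_one_or (Equiv.Perm.sign (Equiv.swap i₀ l)) with h | h <;> simp [h]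
    · have h1 : (1 : Matrix (Fin n) (Fin n) k).updateRow i₀ y
          = 1 + vecMulVec (Pi.single i₀ 1) (y - Pi.single i₀ 1) := by
        ext i j
        rw [Matrix.updateRow_apply, Matrix.add_apply, vecMulVec_apply]
        by_cases h : i = i₀
        · subst h
          simp [Matrix.one_apply, Pi.single_apply, eq_comm]
        · simp [h]
      rw [h1, Matrix.vecMulVec_eq Unit, Matrix.det_one_add_replicateCol_mul_replicateRow]
      simpa using hi₀
  have hrow : ∀ i j, M i j = if i = l then y j else
      (1 : Matrix (Fin n) (Fin n) k) (Equiv.swap i₀ l i) j := by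
    intro i j
    rw [hM, Matrix.submatrix_apply, Matrix.updateRow_apply, id]
    have : Equiv.swap i₀ l i = i₀ ↔ i = l := by
      rw [Equiv.swap_apply_eq_iff, Equiv.swap_apply_left]
    simp only [this]
  refine ⟨GeneralLinearGroup.mkOfDetNeZero M hdet, fun i hi j => ?_, fun i j hij => ?_, ?_⟩
  · change M i j = _
    rw [Fin.lt_def] at hi₀m
    rw [Fin.le_def] at hi
    rw [hrow, if_neg (fun e => by rw [e] at hi; omega), Equiv.swap_apply_of_ne_of_ne
      (fun e => by rw [e] at hi; omega) (fun e => by rw [e] at hi; omega)]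
  · change M i j = _
    rw [hrow]
    split_ifs with hil
    · subst hil
      exact hsupp j (Or.inr (by omega))
    · refine Matrix.one_apply_ne fun e => hij ?_
      rw [← e]
      by_cases hi : i = i₀
      · rw [hi, Equiv.swap_apply_left]; omega
      · rw [Equiv.swap_apply_of_ne_of_ne hi hil]
  · funext j
    change M l j = _
    rw [hrow, if_pos rfl]

variable [Finite k]

lemma colUnip_mem_unip (m : Fin n) (z : Fin n → k) : colUnip m z ∈ unip n k m := by
  refine oneAddVecMulVec_mem_unip _ fun i j hij => ?_
  by_cases hj : j = m
  · subst hj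
    have : ¬ i < j := not_lt.2 (hij.resolve_right (lt_irrefl _))
    simp [this]
  · simp [hj]

lemma unip_anti {m m' : ℕ} (h : m ≤ m') : unip n k m' ≤ unip n k m :=
  fun _ hu i j hij => hu i j (hij.imp_right fun hj => hj.trans_le h)

lemma RowsEqOne.conj_unip {m : Fin n} {h : GL (Fin n) k} (hh : RowsEqOne m h) {u : GL (Fin n) k}
    (hu : u ∈ unip n k (m + 1)) :
    h⁻¹ * u * h ∈ unip n k (m + 1) ∧ superSum (h⁻¹ * u * h).val = superSum u.val := by
  set X : Matrix (Fin n) (Fin n) k := u.val - 1 with hX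
  have hX0 : ∀ i j : Fin n, j ≤ i ∨ (j : ℕ) < m + 1 → X i j = 0 := fun i j hij => by
    rw [hX, Matrix.sub_apply, hu i j hij, sub_self]
  have hXh : X * h.val = X := by
    ext i j
    conv_rhs => rw [← Matrix.mul_one X]
    rw [Matrix.mul_apply, Matrix.mul_apply]
    refine Finset.sum_congr rfl fun l _ => ?_
    rcases le_or_gt m l with hl | hl
    · rw [hh l hl]
    · rw [hX0 i l (Or.inr (by rw [Fin.lt_def] at hl; omega)), zero_mul, zero_mul]
  have hval : (h⁻¹ * u * h).val = 1 + h⁻¹.val * X := by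
    have h1 : u.val = 1 + X := by rw [hX, add_sub_cancel]
    rw [Units.val_mul, Units.val_mul, h1, mul_assoc, add_mul, hXh, one_mul, mul_add,
      ← Units.val_mul, inv_mul_cancel, Units.val_one]
  have hlow : ∀ i j, m ≤ i → (h⁻¹.val * X) i j = X i j := by
    intro i j hi
    rw [Matrix.mul_apply]
    simp [inv_apply_of_row_eq_one (hh i hi), Matrix.one_apply]
  have hleft : ∀ i j : Fin n, (j : ℕ) < m + 1 → (h⁻¹.val * X) i j = 0 := by
    intro i j hj
    rw [Matrix.mul_apply]
    exact Finset.sum_eq_zero fun l _ => by rw [hX0 l j (Or.inr hj), mul_zero]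
  constructor
  · intro i j hij
    rw [hval, Matrix.add_apply, add_eq_left]
    rcases le_or_gt m i with hi | hi
    · rw [hlow i j hi, hX0 i j hij]
    · refine hleft i j (hij.elim (fun hji => ?_) id)
      rw [Fin.lt_def] at hi
      rw [Fin.le_def] at hji
      omega
  · have h1 : u.val = 1 + X := by rw [hX, add_sub_cancel]
    rw [hval, h1, superSum_add, superSum_add]
    congr 1
    refine superSum_congr fun i j hij => ?_
    rcases le_or_gt m i with hi | hi
    · rw [hlow i j hi]
    · rw [Fin.lt_def] at hi
      rw [hleft i j (by omega), hX0 i j (Or.inr (by omega))]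

variable {R : Type} [Field R] {V : Type} [AddCommGroup V] [Module R V]

/-- The vectors on which the upper unitriangular matrices with trivial first `m` columns act
through the generic character attached to `ψ`. -/
def whittaker (ρ : Representation R (GL (Fin n) k) V) (ψ : AddChar k R) (m : ℕ) :
    Submodule R V where
  carrier := {v | ∀ u ∈ unip n k m, ρ u v = ψ (superSum u.val) • v}
  add_mem' := fun {a b} ha hb u hu => by rw [map_add, ha u hu, hb u hu, smul_add]
  zero_mem' := fun u _ => by rw [map_zero, smul_zero]
  smul_mem' := fun c v hv u hu => by rw [map_smul, hv u hu, smul_comm]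

variable {ρ : Representation R (GL (Fin n) k) V} {ψ : AddChar k R}

lemma RowsEqOne.rho_mem_whittaker {m : Fin n} {h : GL (Fin n) k} (hh : RowsEqOne m h) {v : V}
    (hv : v ∈ whittaker ρ ψ (m + 1)) : ρ h v ∈ whittaker ρ ψ (m + 1) := by
  intro u hu
  obtain ⟨h1, h2⟩ := hh.conj_unip hu
  have h3 : u * h = h * (h⁻¹ * u * h) := by group
  rw [← Module.End.mul_apply, ← map_mul, h3, map_mul, Module.End.mul_apply, hv _ h1, h2, map_smul]

lemma rho_apply_of_mem_whittaker {l m : Fin n} (hlm : (m : ℕ) = l + 1) {v : V}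
    (hv : v ∈ whittaker ρ ψ (m + 1)) (c : k) (hc : ∀ z, ρ (colUnip m z) v = ψ (c * z l) • v)
    {u : GL (Fin n) k} (hu : u ∈ unip n k m) :
    ρ u v = ψ (superSum u.val + (c - 1) * u.val l m) • v := by
  set x : Fin n → k := fun i => u.val i m with hx
  set u₂ := colUnip m (-x) * u with hu₂
  have hu₂u : u = colUnip m x * u₂ := by
    rw [hu₂, ← mul_assoc, ← colUnip_add, add_neg_cancel, colUnip_zero, one_mul]
  have hu₂m : u₂ ∈ unip n k m := mul_mem (colUnip_mem_unip m _) hu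
  have hu₂mem : u₂ ∈ unip n k (m + 1) := by
    intro i j hij
    by_cases hj : j ≤ i ∨ (j : ℕ) < m
    · exact hu₂m i j hj
    · rw [not_or, not_le] at hj
      have hjm : j = m := Fin.ext (by have := hij.resolve_left (not_le.2 hj.1); omega)
      subst hjm
      rw [hu₂, Units.val_mul, colUnip_mul_apply, hu j j (Or.inl le_rfl), Matrix.one_apply_eq,
        Matrix.one_apply_ne hj.1.ne, if_pos hj.1]
      simp [hx]
  have hsum : superSum u.val = x l + superSum u₂.val := by
    conv_lhs => rw [hu₂u]
    rw [Units.val_mul, superSum_mul (unip_anti (Nat.zero_le _) (colUnip_mem_unip m x))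
      (unip_anti (Nat.zero_le _) hu₂m), superSum_colUnip hlm]
  rw [hsum]
  conv_lhs => rw [hu₂u]
  rw [map_mul, Module.End.mul_apply, hv u₂ hu₂mem, map_smul, hc, smul_smul,
    ← AddChar.map_add_eq_mul]
  congr 2
  simp only [hx]
  ring

lemma eq_zero_of_colUnip_fixed (hcusp : IsCuspidal k ρ) {l m : Fin n} (hlm : (m : ℕ) = l + 1)
    {v : V} (hv : v ∈ whittaker ρ ψ (m + 1)) (hc : ∀ z, ρ (colUnip m z) v = v) : v = 0 := by
  have hm := m.2
  refine hcusp m (n - m) (by omega) (by omega) (by omega) v fun g hg => ?_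
  have hgm : g ∈ unip n k m := by
    intro i j hij
    refine hg i j fun h => ?_
    rw [Fin.le_def] at hij
    omega
  rw [rho_apply_of_mem_whittaker hlm hv 0
    (fun z => by rw [hc, zero_mul, AddChar.map_zero_eq_one, one_smul]) hgm]
  have : superSum g.val = g.val l m := by
    rw [← superSum_vecMulVec_single (fun i => g.val i m) l m hlm]
    refine superSum_congr fun i j hij => ?_
    rw [vecMulVec_apply]
    by_cases hj : j = m
    · simp [hj]
    · rw [hg i j (fun h => hj (Fin.ext (by omega))),
        Matrix.one_apply_ne (fun e => by rw [e] at hij; omega)]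
      simp [hj]
  rw [this, zero_sub, neg_one_mul, add_neg_cancel, AddChar.map_zero_eq_one, one_smul]

/-- A form invariant under `EvenSupported` matrices that vanishes on the Whittaker vectors of one
level vanishes on those of the next level. -/
lemma apply_eq_zero_of_whittaker_succ (hk : (Nat.card k : R) ≠ 0) (hψ : ∃ x, ψ x ≠ 1)
    (hcusp : IsCuspidal k ρ) {φ : V →ₗ[R] R}
    (hφ : ∀ h : GL (Fin n) k, EvenSupported h → ∀ v, φ (ρ h v) = φ v)
    {l m : Fin n} (hlm : (m : ℕ) = l + 1) (hvan : ∀ v ∈ whittaker ρ ψ m, φ v = 0)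
    {v : V} (hv : v ∈ whittaker ρ ψ (m + 1)) : φ v = 0 := by
  classical
  have := Fintype.ofFinite k
  set F := fourierPart ρ ψ (colUnip m) v with hF
  have hFact : ∀ y z, ρ (colUnip m z) (F y) = ψ (y ⬝ᵥ z) • F y :=
    rho_fourierPart ρ ψ (colUnip_add m) v
  have hFmem : ∀ y, F y ∈ whittaker ρ ψ (m + 1) := fun y =>
    Submodule.sum_mem _ fun z _ => Submodule.smul_mem _ _
      ((rowsEqOne_colUnip m z).rho_mem_whittaker hv)
  have hF0 : ∀ y, φ (F y) = 0 := by
    intro y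
    by_cases hy : y = 0
    · rw [eq_zero_of_colUnip_fixed hcusp hlm (hFmem y)
        (fun z => by rw [hFact, hy, zero_dotProduct, AddChar.map_zero_eq_one, one_smul]), map_zero]
    by_cases hsupp : ∀ i, m ≤ i ∨ (i : ℕ) % 2 = m % 2 → y i = 0
    · obtain ⟨h, hh, heven, hrow⟩ := exists_rowsEqOne_row_eq hlm hy hsupp
      rw [← hφ h heven]
      refine hvan _ fun u hu => ?_
      rw [rho_apply_of_mem_whittaker hlm (hh.rho_mem_whittaker (hFmem y)) 1 (fun z => ?_) hu,
        sub_self, zero_mul, add_zero]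
      obtain ⟨z', hz', hz'l⟩ := hh.colUnip_mul z
      rw [← Module.End.mul_apply, ← map_mul, hz', map_mul, Module.End.mul_apply, hFact, map_smul,
        one_mul, ← hrow, ← hz'l l (by rw [Fin.lt_def]; omega)]
      rfl
    · push Not at hsupp
      obtain ⟨i, hi, hyi⟩ := hsupp
      obtain ⟨x, hx⟩ := exists_addChar_mul_ne hψ hyi
      have heven : EvenSupported (colUnip m (Pi.single i x)) := by
        intro a b hab
        rw [colUnip_apply, Matrix.one_apply_ne (fun e => hab (by rw [e])), zero_add]
        by_cases hb : b = m
        · subst hb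
          split_ifs with ha
          · have : a ≠ i := by
              rintro rfl
              rcases hi with hi | hi
              · exact absurd ha (not_lt.2 hi)
              · exact hab hi
            simp [this]
          · simp
        · simp [hb]
      have h1 := hφ _ heven (F y)
      rw [hFact, map_smul, dotProduct_single, mul_comm, smul_eq_mul] at h1
      rw [mul_zero, AddChar.map_zero_eq_one] at hx
      by_contra h0
      exact hx (mul_right_cancel₀ h0 (h1.trans (one_mul _).symm))
  have hsum := congrArg φ (sum_fourierPart ρ hψ (colUnip_zero m) v)
  rw [map_sum, Finset.sum_eq_zero fun y _ => hF0 y, map_smul, smul_eq_mul, eq_comm,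
    mul_eq_zero] at hsum
  refine hsum.resolve_left ?_
  rw [Fintype.card_fun, ← Nat.card_eq_fintype_card (α := k), Nat.cast_pow]
  exact pow_ne_zero _ hk

theorem eq_zero_of_vanish_on_whittaker (hk : (Nat.card k : R) ≠ 0) (hψ : ∃ x, ψ x ≠ 1)
    (hcusp : IsCuspidal k ρ) {φ : V →ₗ[R] R}
    (hφ : ∀ h : GL (Fin n) k, EvenSupported h → ∀ v, φ (ρ h v) = φ v)
    (hvan : ∀ v ∈ whittaker ρ ψ 0, φ v = 0) : φ = 0 := by
  have key : ∀ d ≤ n, ∀ v ∈ whittaker ρ ψ d, φ v = 0 := by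
    intro d
    induction d with
    | zero => exact fun _ => hvan
    | succ d ih =>
      intro hd v hv
      obtain rfl | ⟨d, rfl⟩ : d = 0 ∨ ∃ d', d = d' + 1 := by
        cases d with
        | zero => exact Or.inl rfl
        | succ d => exact Or.inr ⟨d, rfl⟩
      · refine hvan v fun u hu => hv u fun i j hij => hu i j (Or.inl ?_)
        rw [Fin.le_def] at hij ⊢
        omega
      · exact apply_eq_zero_of_whittaker_succ hk hψ hcusp hφ (l := ⟨d, by omega⟩)
          (m := ⟨d + 1, by omega⟩) rfl (ih (by omega)) hv
  ext v
  refine key n le_rfl v fun u hu => ?_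
  have : u = 1 := Units.ext (by ext i j; exact hu i j (Or.inr j.2))
  rw [this, map_one, Units.val_one, superSum_one, AddChar.map_zero_eq_one, one_smul]
  rfl

end Descent

section LeviConjugation

variable {n : ℕ} {k : Type} [Field k]

lemma exists_perm_twoBlocks {r : ℕ} (hn : n = 2 * r) :
    ∃ σ : Equiv.Perm (Fin n), ∀ i, twoBlocks n r (σ i) = if (i : ℕ) % 2 = 0 then 0 else 1 := by
  let f : Fin n → Fin n := fun i =>
    ⟨if (i : ℕ) % 2 = 0 then i / 2 else i / 2 + r, by have := i.2; split_ifs <;> omega⟩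
  have hf : Function.Injective f := by
    intro i j hij
    have h := congrArg Fin.val hij
    simp only [f] at h
    have := i.2
    have := j.2
    apply Fin.ext
    split_ifs at h <;> omega
  refine ⟨Equiv.ofBijective f hf.bijective_of_finite, fun i => ?_⟩
  have := i.2
  change (if (if (i : ℕ) % 2 = 0 then (i : ℕ) / 2 else i / 2 + r) < r then (0 : Fin 2) else 1) = _
  split_ifs <;> first | rfl | omega

lemma exists_conj_mem_levi {r : ℕ} (hn : n = 2 * r) :
    ∃ w : GL (Fin n) k, ∀ h, EvenSupported h → w * h * w⁻¹ ∈ levi k n 2 (twoBlocks n r) := by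
  obtain ⟨σ, hσ⟩ := exists_perm_twoBlocks hn
  let P (τ : Equiv.Perm (Fin n)) : Matrix (Fin n) (Fin n) k :=
    (1 : Matrix (Fin n) (Fin n) k).submatrix τ id
  have hPl : ∀ τ (M : Matrix (Fin n) (Fin n) k), P τ * M = M.submatrix τ id := by
    intro τ M
    ext i j
    simp [P, Matrix.mul_apply, Matrix.one_apply]
  have hPr : ∀ (τ : Equiv.Perm (Fin n)) (M : Matrix (Fin n) (Fin n) k),
      M * P τ = M.submatrix id τ.symm := by
    intro τ M
    ext i j
    simp [P, Matrix.mul_apply, Matrix.one_apply, ← Equiv.eq_symm_apply]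
  let w : GL (Fin n) k :=
    { val := P σ.symm
      inv := P σ
      val_inv := by
        rw [hPl]
        ext i j
        change (1 : Matrix (Fin n) (Fin n) k) (σ (σ.symm i)) j = _
        rw [Equiv.apply_symm_apply]
      inv_val := by
        rw [hPl]
        ext i j
        change (1 : Matrix (Fin n) (Fin n) k) (σ.symm (σ i)) j = _
        rw [Equiv.symm_apply_apply] }
  refine ⟨w, fun h hh i j hij => ?_⟩
  change (P σ.symm * h.val * P σ) i j = 0
  rw [hPr, hPl, Matrix.submatrix_apply, Matrix.submatrix_apply]
  refine hh _ _ fun e => hij ?_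
  have h1 := hσ (σ.symm i)
  have h2 := hσ (σ.symm j)
  rw [Equiv.apply_symm_apply] at h1 h2
  rw [h1, h2]
  simp only [id] at e
  rw [e]

end LeviConjugation

/-- For `n = 2r` and `ρ` cuspidal irreducible, the space of
`(GL r × GL r)(k)`-invariant linear forms on `ρ` has dimension at most `1`. -/
theorem cuspidal_levi_multiplicity_le_one
    (p : ℕ) [Fact p.Prime] (hp : p ≠ 2)
    (k : Type) [Field k] [Fintype k] [CharP k p]
    (R : Type) [Field R] [IsAlgClosed R] (hchar : ringChar R ≠ p)
    (n r : ℕ) (hr : 1 ≤ r) (hn : n = 2 * r)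
    (V : Type) [AddCommGroup V] [Module R V]
    (ρ : Representation R (GL (Fin n) k) V)
    (hirr : IsIrreducibleRep ρ) (hcusp : IsCuspidal k ρ) :
    Module.rank R
      ↥(invariantForms ρ (levi k n 2 (twoBlocks n r) : Set (GL (Fin n) k))) ≤ 1 := by
  have hkp : ringChar k = p := ringChar.eq k p
  obtain ⟨ψ, hψ⟩ := exists_addChar_ne_one k R (by rw [hkp]; exact hchar)
  have hk : (Nat.card k : R) ≠ 0 := by
    obtain ⟨m, hp', hm⟩ := FiniteField.card k p
    rw [Nat.card_eq_fintype_card, hm, Nat.cast_pow]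
    refine pow_ne_zero _ fun h0 => ?_
    rw [ringChar.spec, Nat.dvd_prime hp'] at h0
    exact h0.elim CharP.ringChar_ne_one hchar
  obtain ⟨w, hw⟩ := exists_conj_mem_levi (k := k) hn
  set S := invariantForms ρ (levi k n 2 (twoBlocks n r) : Set (GL (Fin n) k)) with hS
  have hinv : ∀ φ ∈ S, (∀ v ∈ whittaker ρ ψ 0, φ (ρ w v) = 0) → φ = 0 := by
    intro φ hφ hvan
    have h1 : φ ∘ₗ ρ w = 0 := by
      refine eq_zero_of_vanish_on_whittaker hk hψ hcusp (fun h hh v => ?_) hvan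
      have h2 := hφ _ (hw h hh) (ρ w v)
      rw [← Module.End.mul_apply, ← map_mul, inv_mul_cancel_right, map_mul] at h2
      exact h2
    ext v
    have h2 := LinearMap.congr_fun h1 (ρ w⁻¹ v)
    rwa [LinearMap.comp_apply, ← Module.End.mul_apply, ← map_mul, mul_inv_cancel, map_one] at h2
  have : Module.Free R S := Module.Free.of_divisionRing R S
  refine (rank_le_one_iff (K := R) (V := S)).2 ?_
  by_cases hex : ∃ φ₀ : S, ∃ v ∈ whittaker ρ ψ 0, φ₀.1 (ρ w v) ≠ 0
  · obtain ⟨φ₀, v, hv, hne⟩ := hex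
    have hv0 : v ≠ 0 := by
      rintro rfl
      simp at hne
    refine ⟨φ₀, fun φ => ⟨φ.1 (ρ w v) / φ₀.1 (ρ w v), ?_⟩⟩
    rw [← sub_eq_zero]
    refine Subtype.ext (hinv _ (Subtype.prop _) fun x hx => ?_)
    obtain ⟨c, rfl⟩ := whittaker_unique hirr hψ hk hv hx hv0
    change φ.1 (ρ w v) / φ₀.1 (ρ w v) * φ₀.1 (ρ w (c • v)) - φ.1 (ρ w (c • v)) = 0
    rw [map_smul, map_smul, map_smul, smul_eq_mul, smul_eq_mul]
    field_simp
    ring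
  · push Not at hex
    refine ⟨0, fun φ => ⟨0, ?_⟩⟩
    rw [smul_zero]
    exact (Subtype.ext (hinv φ.1 φ.2 (hex φ))).symm
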